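/- arXiv:1709.00877 — 5 statements merged into one kernel-verified Lean document; each statement's English description precedes it below -/
import Mathlib

section
/- Let n ≥ 2 and let f : Fin n × Fin n → Fin 3 be a configuration. If the reading sequence λ_DA is strictly greater in lexicographic order than each of the other seven reading sequences λ_DC, λ_AD, λ_AB, λ_BA, λ_BC, λ_CB, λ_CD, then f is asymmetric, i.e., f ≠ f ∘ σ for every non-identity symmetry σ of the square. -/
/-! ## Basic definitions: configurations on the n×n grid, reading sequences,
symmetries of the square, and the configuration classes from the paper. -/

theorem sidePos {n : ℕ} (k : Fin (n * n)) : 0 < n := by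
  rcases Nat.eq_zero_or_pos n with h | h
  · exact absurd k.2 (by simp [h])
  · exact h

/-- For an index `k = n*j + i` (column-major reading), the row `i = k % n`. -/
def rowOf {n : ℕ} (k : Fin (n * n)) : Fin n :=
  ⟨k.val % n, Nat.mod_lt _ (sidePos k)⟩

/-- For an index `k = n*j + i` (column-major reading), the column `j = k / n`. -/
def colOf {n : ℕ} (k : Fin (n * n)) : Fin n :=
  ⟨k.val / n, (Nat.div_lt_iff_lt_mul (sidePos k)).2 k.2⟩

/-- λ_DA(n·j+i) = f(i,j) -/
def lamDA {n : ℕ} (f : Fin n × Fin n → Fin 3) : Fin (n * n) → Fin 3 :=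
  fun k => f (rowOf k, colOf k)

/-- λ_DC(n·i+j) = f(i,j) -/
def lamDC {n : ℕ} (f : Fin n × Fin n → Fin 3) : Fin (n * n) → Fin 3 :=
  fun k => f (colOf k, rowOf k)

/-- λ_AD(n·j+i) = f(n-1-i,j) -/
def lamAD {n : ℕ} (f : Fin n × Fin n → Fin 3) : Fin (n * n) → Fin 3 :=
  fun k => f ((rowOf k).rev, colOf k)

/-- λ_AB(n·i+j) = f(n-1-i,j) -/
def lamAB {n : ℕ} (f : Fin n × Fin n → Fin 3) : Fin (n * n) → Fin 3 :=
  fun k => f ((colOf k).rev, rowOf k)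

/-- λ_BA(n·j+i) = f(n-1-i,n-1-j) -/
def lamBA {n : ℕ} (f : Fin n × Fin n → Fin 3) : Fin (n * n) → Fin 3 :=
  fun k => f ((rowOf k).rev, (colOf k).rev)

/-- λ_BC(n·i+j) = f(n-1-i,n-1-j) -/
def lamBC {n : ℕ} (f : Fin n × Fin n → Fin 3) : Fin (n * n) → Fin 3 :=
  fun k => f ((colOf k).rev, (rowOf k).rev)

/-- λ_CB(n·j+i) = f(i,n-1-j) -/
def lamCB {n : ℕ} (f : Fin n × Fin n → Fin 3) : Fin (n * n) → Fin 3 :=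
  fun k => f (rowOf k, (colOf k).rev)

/-- λ_CD(n·i+j) = f(i,n-1-j) -/
def lamCD {n : ℕ} (f : Fin n × Fin n → Fin 3) : Fin (n * n) → Fin 3 :=
  fun k => f (colOf k, (rowOf k).rev)

/-- horizontal reflection h(i,j) = (n-1-i, j) -/
def symH {n : ℕ} (p : Fin n × Fin n) : Fin n × Fin n := (p.1.rev, p.2)

/-- vertical reflection v(i,j) = (i, n-1-j) -/
def symV {n : ℕ} (p : Fin n × Fin n) : Fin n × Fin n := (p.1, p.2.rev)

/-- half turn r2(i,j) = (n-1-i, n-1-j) -/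
def symR2 {n : ℕ} (p : Fin n × Fin n) : Fin n × Fin n := (p.1.rev, p.2.rev)

/-- quarter turn r1(i,j) = (j, n-1-i) -/
def symR1 {n : ℕ} (p : Fin n × Fin n) : Fin n × Fin n := (p.2, p.1.rev)

/-- quarter turn r1⁻¹(i,j) = (n-1-j, i) -/
def symR1inv {n : ℕ} (p : Fin n × Fin n) : Fin n × Fin n := (p.2.rev, p.1)

/-- diagonal reflection d(i,j) = (j, i) -/
def symD {n : ℕ} (p : Fin n × Fin n) : Fin n × Fin n := (p.2, p.1)

/-- antidiagonal reflection a(i,j) = (n-1-j, n-1-i) -/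
def symA {n : ℕ} (p : Fin n × Fin n) : Fin n × Fin n := (p.2.rev, p.1.rev)

/-- `f` is asymmetric: not invariant under any non-identity symmetry of the square. -/
def Asymmetric {n : ℕ} (f : Fin n × Fin n → Fin 3) : Prop :=
  ∀ σ ∈ [symH (n := n), symV, symR2, symR1, symR1inv, symD, symA], f ≠ f ∘ σ

/-- `f` is partitive: invariant under one of h, v, r1, r1⁻¹, r2. -/
def PartitiveSq {n : ℕ} (f : Fin n × Fin n → Fin 3) : Prop :=
  ∃ σ ∈ [symH (n := n), symV, symR1, symR1inv, symR2], f = f ∘ σ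

/-- all four corner nodes are empty -/
def CornersEmpty {n : ℕ} (f : Fin n × Fin n → Fin 3) : Prop :=
  ∀ p : Fin n × Fin n, (p.1.val = 0 ∨ p.1.val = n - 1) → (p.2.val = 0 ∨ p.2.val = n - 1) → f p = 0

/-- `f` takes no value 2 (no multiplicities) -/
def NoMult {n : ℕ} (f : Fin n × Fin n → Fin 3) : Prop := ∀ p, f p ≠ 2

/-- λ_DA is lexicographically strictly greater than the other seven reading sequences -/
def DAStrictMax {n : ℕ} (f : Fin n × Fin n → Fin 3) : Prop :=
  ∀ s ∈ [lamDC f, lamAD f, lamAB f, lamBA f, lamBC f, lamCB f, lamCD f],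
    toLex s < toLex (lamDA f)

/-- λ_DA is lexicographically largest among the eight reading sequences -/
def DAMax {n : ℕ} (f : Fin n × Fin n → Fin 3) : Prop :=
  ∀ s ∈ [lamDC f, lamAD f, lamAB f, lamBA f, lamBC f, lamCB f, lamCD f],
    toLex s ≤ toLex (lamDA f)

/-- replace the first nonzero entry of a sequence by 0 -/
def zeroFirst {N : ℕ} (s : Fin N → Fin 3) : Fin N → Fin 3 :=
  fun k => if s k ≠ 0 ∧ ∀ j < k, s j = 0 then 0 else s k

/-- `s` attains the lexicographic maximum of the four corner sequences
{λ_AD, λ_AB, λ_CB, λ_CD} of `f`. -/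
def AttainsMax4 {n : ℕ} (f : Fin n × Fin n → Fin 3) (s : Fin (n * n) → Fin 3) : Prop :=
  ∀ t ∈ [lamAD f, lamAB f, lamCB f, lamCD f], toLex t ≤ toLex s

/-- A is the second largest corner: the max of the four corner sequences is attained
by λ_AD or λ_AB -/
def SecondIsA {n : ℕ} (f : Fin n × Fin n → Fin 3) : Prop :=
  AttainsMax4 f (lamAD f) ∨ AttainsMax4 f (lamAB f)

/-- C is the second largest corner -/
def SecondIsC {n : ℕ} (f : Fin n × Fin n → Fin 3) : Prop :=
  AttainsMax4 f (lamCB f) ∨ AttainsMax4 f (lamCD f)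

/-- the row i = 0 (side DC) contains at least one robot -/
def Row0HasRobot {n : ℕ} (f : Fin n × Fin n → Fin 3) : Prop :=
  ∃ p : Fin n × Fin n, p.1.val = 0 ∧ f p ≠ 0

/-- almost symmetric of the first type, largest corner D -/
def AlmostSym1 {n : ℕ} (f : Fin n × Fin n → Fin 3) : Prop :=
  CornersEmpty f ∧ NoMult f ∧ Asymmetric f ∧ DAStrictMax f ∧ Row0HasRobot f ∧
    zeroFirst (lamDA f) = zeroFirst (lamDC f)

/-- almost symmetric of the second type, largest corner D (second largest corner A or C) -/
def AlmostSym2 {n : ℕ} (f : Fin n × Fin n → Fin 3) : Prop :=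
  CornersEmpty f ∧ NoMult f ∧ Asymmetric f ∧ DAStrictMax f ∧
    ((SecondIsA f ∧ zeroFirst (lamAD f) = zeroFirst (lamAB f)) ∨
     (SecondIsC f ∧ zeroFirst (lamCB f) = zeroFirst (lamCD f)))

/-- almost symmetric of the second type with largest corner D and second largest corner A -/
def AlmostSym2A {n : ℕ} (f : Fin n × Fin n → Fin 3) : Prop :=
  CornersEmpty f ∧ NoMult f ∧ Asymmetric f ∧ DAStrictMax f ∧ SecondIsA f ∧
    zeroFirst (lamAD f) = zeroFirst (lamAB f)

/-- symmetric of the first type, largest corner D -/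
def SymFirstType {n : ℕ} (f : Fin n × Fin n → Fin 3) : Prop :=
  CornersEmpty f ∧ f = f ∘ symD ∧ ¬ PartitiveSq f ∧ DAMax f

/-- symmetric of the second type, largest corner D -/
def SymSecondType {n : ℕ} (f : Fin n × Fin n → Fin 3) : Prop :=
  CornersEmpty f ∧ f = f ∘ symA ∧ ¬ PartitiveSq f ∧ DAMax f

/-- symmetric of the second type, largest corner D and second largest corner A -/
def SymSecondTypeA {n : ℕ} (f : Fin n × Fin n → Fin 3) : Prop :=
  SymSecondType f ∧ SecondIsA f

/-- purely asymmetric with largest corner D -/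
def PurelyAsym {n : ℕ} (f : Fin n × Fin n → Fin 3) : Prop :=
  CornersEmpty f ∧ Asymmetric f ∧ DAStrictMax f ∧ ¬ AlmostSym1 f ∧ ¬ AlmostSym2 f

/-- position of a node in the λ_DA reading order -/
def idxDA {n : ℕ} (p : Fin n × Fin n) : ℕ := n * p.2.val + p.1.val

/-- `u` is the first occupied node of `f` in λ_DA-order -/
def FirstRobot {n : ℕ} (f : Fin n × Fin n → Fin 3) (u : Fin n × Fin n) : Prop :=
  f u ≠ 0 ∧ ∀ p, f p ≠ 0 → idxDA u ≤ idxDA p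

/-- `u₂` is the second occupied node of `f` in λ_DA-order (after `u₁`) -/
def SecondRobot {n : ℕ} (f : Fin n × Fin n → Fin 3) (u₁ u₂ : Fin n × Fin n) : Prop :=
  f u₂ ≠ 0 ∧ u₂ ≠ u₁ ∧ ∀ p, f p ≠ 0 → p ≠ u₁ → idxDA u₂ ≤ idxDA p

/-- destination of the one-step movement rule toward D for a robot at node `p = (i,j)`:
columnwise to (i-1,j) if j = 0, or (j = 1 and i > 1), or (i = n-1 and j+1 ≤ n/2);
otherwise rowwise to (i, j-1). -/
def destD {n : ℕ} (p : Fin n × Fin n) : Fin n × Fin n :=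
  if p.2.val = 0 ∨ (p.2.val = 1 ∧ 1 < p.1.val) ∨ (p.1.val = n - 1 ∧ p.2.val + 1 ≤ n / 2) then
    (⟨p.1.val - 1, lt_of_le_of_lt (Nat.sub_le _ _) p.1.2⟩, p.2)
  else
    (p.1, ⟨p.2.val - 1, lt_of_le_of_lt (Nat.sub_le _ _) p.2.2⟩)

/-- the configuration after a robot moves from node `u` to node `w` -/
def moveCfg {n : ℕ} (f : Fin n × Fin n → Fin 3) (u w : Fin n × Fin n) :
    Fin n × Fin n → Fin 3 :=
  fun p => if p = u then f u - 1 else if p = w then f w + 1 else f p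

/-- If λ_DA is strictly lexicographically greater than the other seven reading
sequences, then the configuration is asymmetric. -/
theorem strict_max_implies_asymmetric (n : ℕ) (hn : 2 ≤ n)
    (f : Fin n × Fin n → Fin 3) (hmax : DAStrictMax f) :
    Asymmetric f := by
  intro σ hσ hf
  -- reading `f ∘ σ` from `D` towards `A` is one of the other seven readings of `f`
  have hmem : lamDA (f ∘ σ) ∈
      [lamDC f, lamAD f, lamAB f, lamBA f, lamBC f, lamCB f, lamCD f] := by
    have h1 : lamDA (f ∘ symH) = lamAD f := rfl
    have h2 : lamDA (f ∘ symV) = lamCB f := rfl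
    have h3 : lamDA (f ∘ symR2) = lamBA f := rfl
    have h4 : lamDA (f ∘ symR1) = lamCD f := rfl
    have h5 : lamDA (f ∘ symR1inv) = lamAB f := rfl
    have h6 : lamDA (f ∘ symD) = lamDC f := rfl
    have h7 : lamDA (f ∘ symA) = lamBC f := rfl
    simp only [List.mem_cons, List.not_mem_nil, or_false] at hσ
    rcases hσ with rfl | rfl | rfl | rfl | rfl | rfl | rfl
    · rw [h1]; simp
    · rw [h2]; simp
    · rw [h3]; simp
    · rw [h4]; simp
    · rw [h5]; simp
    · rw [h6]; simp
    · rw [h7]; simp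
  have hlt := hmax _ hmem
  rw [← hf] at hlt
  exact lt_irrefl _ hlt
end

section
/- Let n ≥ 4 be even and let f : Fin n × Fin n → Fin 3 be a configuration that is symmetric of the first type or almost symmetric of the first type, with largest corner D. Let r_1 be the robot on side DA closest to D, at node (x-1, 0) (the x-th node from D, 1-indexed, x ≥ 2), and r_2 the robot on side DC closest to D, at node (0, y-1) (the y-th node from D, y ≥ 2). Let f' be obtained from f by moving r_1 to (x-2, 0), or moving r_2 to (0, y-2), or both. Then f' is not partitive: f' ≠ f' ∘ σ for every σ ∈ {h, v, r1, r1⁻¹, r2}. -/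
theorem lex_zero_prefix {N : ℕ} (s t : Fin N → Fin 3) (h : toLex s ≤ toLex t) (m : ℕ)
    (ht : ∀ j : Fin N, j.val < m → t j = 0) (j : Fin N) (hj : j.val < m) : s j = 0 := by
  rcases h.eq_or_lt with h | h
  · have : s = t := toLex.injective h
    rw [this]; exact ht j hj
  · obtain ⟨i, hi, hlt⟩ := h
    change ∀ j, j < i → s j = t j at hi
    change s i < t i at hlt
    by_cases hji : j < i
    · rw [hi j hji]; exact ht j hj
    · have hij : i.val ≤ j.val := by simpa using hji
      rw [ht i (by omega)] at hlt
      exact absurd hlt (by simp)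

def idxOf {n : ℕ} (i j : Fin n) : Fin (n * n) :=
  ⟨n * j.val + i.val, by
    have h1 := i.2
    have h2 : n * (j.val + 1) ≤ n * n := Nat.mul_le_mul_left n j.2
    rw [Nat.mul_add] at h2
    omega⟩

theorem rowOf_idxOf {n : ℕ} (i j : Fin n) : rowOf (idxOf i j) = i := by
  apply Fin.ext
  simp [rowOf, idxOf, Nat.mul_add_mod, Nat.mod_eq_of_lt i.2]

theorem colOf_idxOf {n : ℕ} (i j : Fin n) : colOf (idxOf i j) = j := by
  apply Fin.ext
  have : 0 < n := i.pos
  simp [colOf, idxOf, Nat.mul_add_div this, Nat.div_eq_of_lt i.2]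

theorem zeroFirst_of_earlier {N : ℕ} (s : Fin N → Fin 3) (j k : Fin N) (h : j < k)
    (hj : s j ≠ 0) : zeroFirst s k = s k := by
  unfold zeroFirst
  rw [if_neg]
  rintro ⟨-, h2⟩
  exact hj (h2 j h)

theorem sym_of_zeroFirst {n : ℕ} (f : Fin n × Fin n → Fin 3) (z a b : Fin n) (hz : z.val = 0)
    (ha : f (a, z) ≠ 0) (hb : f (z, b) ≠ 0)
    (h : zeroFirst (lamDA f) = zeroFirst (lamDC f)) : f = f ∘ symD := by
  have key : ∀ i j : Fin n, j.val ≠ 0 → f (i, j) = f (j, i) := by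
    intro i j hj
    have hk := congrFun h (idxOf i j)
    have hlt : ∀ c : Fin n, idxOf c z < idxOf i j := by
      intro c
      show n * z.val + c.val < n * j.val + i.val
      have h1 := c.2
      have h2 : n * 1 ≤ n * j.val := Nat.mul_le_mul_left n (by omega)
      rw [hz]; omega
    rw [zeroFirst_of_earlier _ (idxOf a z) _ (hlt a) (by simpa [lamDA, rowOf_idxOf, colOf_idxOf]),
      zeroFirst_of_earlier _ (idxOf b z) _ (hlt b) (by simpa [lamDC, rowOf_idxOf, colOf_idxOf])] at hk
    simpa [lamDA, lamDC, rowOf_idxOf, colOf_idxOf] using hk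
  funext ⟨i, j⟩
  show f (i, j) = f (j, i)
  by_cases hj : j.val = 0
  · by_cases hi : i.val = 0
    · have : i = j := Fin.ext (by omega)
      rw [this]
    · exact (key j i hi).symm
  · exact key i j hj

theorem moveCfg_zero {n : ℕ} (f : Fin n × Fin n → Fin 3) (u w q : Fin n × Fin n)
    (hu : f u ≠ 0) (hq : f q = 0) (hw : q ≠ w) : moveCfg f u w q = 0 := by
  have : q ≠ u := by rintro rfl; exact hu hq
  simp [moveCfg, this, hw, hq]

/-- The prefix of zeros of the largest reading is shared by the four readings used below
together with their transposes. -/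
theorem zero_prefix_all {n : ℕ} (f : Fin n × Fin n → Fin 3) (hM : DAMax f) (z : Fin n)
    (hz : z.val = 0) (m : ℕ) (hm : m ≤ n) (h0 : ∀ i : Fin n, i.val < m → f (i, z) = 0)
    (i : Fin n) (hi : i.val < m) :
    f (i.rev, z) = 0 ∧ f (z.rev, i) = 0 ∧ f (i.rev, z.rev) = 0 ∧ f (z.rev, i.rev) = 0 ∧
      f (i, z.rev) = 0 ∧ f (z, i.rev) = 0 := by
  have h0' : ∀ k : Fin (n * n), k.val < m → lamDA f k = 0 := by
    intro k hk
    have hc : colOf k = z := Fin.ext (by simp [colOf, hz]; right; omega)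
    have hr : (rowOf k).val < m := by
      have : k.val % n = k.val := Nat.mod_eq_of_lt (by omega)
      simp [rowOf, this, hk]
    simp [lamDA, hc, h0 _ hr]
  have H : ∀ s ∈ [lamDC f, lamAD f, lamAB f, lamBA f, lamBC f, lamCB f, lamCD f],
      s (idxOf i z) = 0 := fun s hs =>
    lex_zero_prefix s _ (hM s hs) m h0' (idxOf i z) (by simp [idxOf, hz, hi])
  simp only [List.mem_cons, List.not_mem_nil, or_false, forall_eq_or_imp, forall_eq,
    lamDC, lamAD, lamAB, lamBA, lamBC, lamCB, lamCD, rowOf_idxOf, colOf_idxOf] at H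
  tauto

/-- Lemma 2.2 (part 2): in a configuration symmetric or almost symmetric of the first
type (largest corner D), one move made by one or both of the leading duo toward D does
not create a partitive configuration. -/
theorem first_type_move_not_partitive (n : ℕ) (hn : 4 ≤ n) (hne : Even n)
    (f : Fin n × Fin n → Fin 3)
    (hf : SymFirstType f ∨ AlmostSym1 f)
    (x y : ℕ) (hx2 : 2 ≤ x) (hxn : x ≤ n) (hy2 : 2 ≤ y) (hyn : y ≤ n)
    -- r₁ is the robot on side DA closest to D, at the x-th node from D
    (hr1 : f (⟨x - 1, by omega⟩, ⟨0, by omega⟩) ≠ 0)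
    (hr1c : ∀ i : Fin n, i.val < x - 1 → f (i, ⟨0, by omega⟩) = 0)
    -- r₂ is the robot on side DC closest to D, at the y-th node from D
    (hr2 : f (⟨0, by omega⟩, ⟨y - 1, by omega⟩) ≠ 0)
    (hr2c : ∀ j : Fin n, j.val < y - 1 → f (⟨0, by omega⟩, j) = 0)
    (f' : Fin n × Fin n → Fin 3)
    (hf' :
      f' = moveCfg f (⟨x - 1, by omega⟩, ⟨0, by omega⟩) (⟨x - 2, by omega⟩, ⟨0, by omega⟩) ∨
      f' = moveCfg f (⟨0, by omega⟩, ⟨y - 1, by omega⟩) (⟨0, by omega⟩, ⟨y - 2, by omega⟩) ∨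
      f' = moveCfg (moveCfg f (⟨x - 1, by omega⟩, ⟨0, by omega⟩) (⟨x - 2, by omega⟩, ⟨0, by omega⟩))
             (⟨0, by omega⟩, ⟨y - 1, by omega⟩) (⟨0, by omega⟩, ⟨y - 2, by omega⟩)) :
    ¬ PartitiveSq f' := by
  have hS : SymFirstType f := by
    rcases hf with h | ⟨-, -, hA, -, -, hz⟩
    · exact h
    · exact absurd (sym_of_zeroFirst f ⟨0, by omega⟩ _ _ rfl hr1 hr2 hz) (hA symD (by simp))
  obtain ⟨hC, hD, -, hM⟩ := hS
  have hsym : ∀ i j : Fin n, f (i, j) = f (j, i) := fun i j => congrFun hD (i, j)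
  have hxy : x = y := by
    rcases lt_trichotomy x y with h | h | h
    · exact absurd (by rw [hsym]; exact hr2c ⟨x - 1, by omega⟩ (by simp; omega)) hr1
    · exact h
    · exact absurd (by rw [hsym]; exact hr1c ⟨y - 1, by omega⟩ (by simp; omega)) hr2
  subst hxy
  have hxn' : x ≠ n := by
    intro h
    exact hr1 (hC _ (Or.inr (by simp [h])) (Or.inl rfl))
  obtain ⟨e, he⟩ := hne
  obtain ⟨h1, h2, h3, h4, h5, h6⟩ := zero_prefix_all f hM ⟨0, by omega⟩ rfl (x - 1) (by omega) hr1c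
    ⟨x - 2, by omega⟩ (by simp; omega)
  have hw1 : f (⟨x - 2, by omega⟩, ⟨0, by omega⟩) = 0 := hr1c _ (by simp; omega)
  have hw2 : f (⟨0, by omega⟩, ⟨x - 2, by omega⟩) = 0 := hr2c _ (by simp; omega)
  rintro ⟨σ, hσ, hfix⟩
  rcases hf' with hf' | hf' | hf'
  · have hp := congrFun hfix (⟨x - 2, by omega⟩, ⟨0, by omega⟩)
    have hne0 : f' (⟨x - 2, by omega⟩, ⟨0, by omega⟩) ≠ 0 := by
      rw [hf', moveCfg, if_neg (by simp; omega), if_pos rfl, hw1]; decide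
    apply hne0
    rw [hp, hf', Function.comp_apply]
    simp only [List.mem_cons, List.not_mem_nil, or_false] at hσ
    rcases hσ with rfl | rfl | rfl | rfl | rfl <;>
      refine moveCfg_zero _ _ _ _ hr1 (by assumption) ?_ <;>
      simp [symH, symV, symR1, symR1inv, symR2, Prod.ext_iff, Fin.ext_iff] <;> omega
  · have hp := congrFun hfix (⟨0, by omega⟩, ⟨x - 2, by omega⟩)
    have hne0 : f' (⟨0, by omega⟩, ⟨x - 2, by omega⟩) ≠ 0 := by
      rw [hf', moveCfg, if_neg (by simp; omega), if_pos rfl, hw2]; decide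
    apply hne0
    rw [hp, hf', Function.comp_apply]
    simp only [List.mem_cons, List.not_mem_nil, or_false] at hσ
    rcases hσ with rfl | rfl | rfl | rfl | rfl <;>
      refine moveCfg_zero _ _ _ _ hr2 (by assumption) ?_ <;>
      simp [symH, symV, symR1, symR1inv, symR2, Prod.ext_iff, Fin.ext_iff] <;> omega
  · have hp := congrFun hfix (⟨x - 2, by omega⟩, ⟨0, by omega⟩)
    have hu2 : moveCfg f (⟨x - 1, by omega⟩, ⟨0, by omega⟩) (⟨x - 2, by omega⟩, ⟨0, by omega⟩)
        (⟨0, by omega⟩, ⟨x - 1, by omega⟩) ≠ 0 := by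
      rw [moveCfg, if_neg (by simp; omega), if_neg (by simp; omega)]
      exact hr2
    have hw : moveCfg f (⟨x - 1, by omega⟩, ⟨0, by omega⟩) (⟨x - 2, by omega⟩, ⟨0, by omega⟩)
        (⟨x - 2, by omega⟩, ⟨0, by omega⟩) = 1 := by
      rw [moveCfg, if_neg (by simp; omega), if_pos rfl, hw1]; decide
    have hne0 : f' (⟨x - 2, by omega⟩, ⟨0, by omega⟩) ≠ 0 := by
      rw [hf', moveCfg, if_neg (by simp; omega)]
      split_ifs with hc
      · rw [← hc, hw]; decide
      · rw [hw]; decide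
    apply hne0
    rw [hp, hf', Function.comp_apply]
    simp only [List.mem_cons, List.not_mem_nil, or_false] at hσ
    rcases hσ with rfl | rfl | rfl | rfl | rfl <;>
      refine moveCfg_zero _ _ _ _ hu2 (moveCfg_zero _ _ _ _ hr1 (by assumption) ?_) ?_ <;>
      simp [symH, symV, symR1, symR1inv, symR2, Prod.ext_iff, Fin.ext_iff] <;> omega
end

section
/- Let n ≥ 4 be even and let f : Fin n × Fin n → Fin 3 be purely asymmetric with largest corner D, whose first occupied node in λ_DA-order is a singleton. Suppose the second robot r_2 of the leading duo, at node (i,j), moves one step according to the movement rule toward D, to a destination node w with f(w) ≤ 1, producing f'. Then λ_DA of f' is strictly greater in lexicographic order than λ_CD of f'. -/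
theorem aux_lex_iff {N : ℕ} (a b : Fin N → Fin 3) :
    toLex a < toLex b ↔ ∃ k, (∀ m < k, a m = b m) ∧ a k < b k := Iff.rfl

theorem aux_move_ne {n : ℕ} (f : Fin n × Fin n → Fin 3) (u w p : Fin n × Fin n)
    (h1 : p ≠ u) (h2 : p ≠ w) : moveCfg f u w p = f p := by
  simp [moveCfg, h1, h2]

theorem aux_dm {n : ℕ} (m : Fin (n * n)) :
    n * (colOf m).val + (rowOf m).val = m.val := Nat.div_add_mod _ _

theorem aux_idx {n : ℕ} (i j : Fin n) :
    ∃ k : Fin (n * n), rowOf k = i ∧ colOf k = j ∧ k.val = n * j.val + i.val := by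
  have hi := i.2
  have hj := j.2
  have hlt : n * j.val + i.val < n * n := by nlinarith
  refine ⟨⟨_, hlt⟩, ?_, ?_, rfl⟩
  · apply Fin.ext
    simp [rowOf, Nat.mul_add_mod, Nat.mod_eq_of_lt hi]
  · apply Fin.ext
    simp [colOf, Nat.mul_add_div (by omega : 0 < n), Nat.div_eq_of_lt hi]

theorem aux_add {x : Fin 3} (h : x ≤ 1) : x < x + 1 := by revert x; decide

theorem aux_sub {x : Fin 3} (h : x ≠ 0) : x - 1 < x := by revert x; decide

/-- DA increases when the destination precedes the source. -/
theorem aux_DA {n : ℕ} (f : Fin n × Fin n → Fin 3) (u w : Fin n × Fin n)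
    (hwv : f w ≤ 1) (hlt : idxDA w < idxDA u) :
    ∃ k : Fin (n * n), k.val = idxDA w ∧
      (∀ m < k, lamDA (moveCfg f u w) m = lamDA f m) ∧
      lamDA f k < lamDA (moveCfg f u w) k := by
  obtain ⟨k, hr, hc, hk⟩ := aux_idx w.1 w.2
  have hne : w ≠ u := by rintro rfl; omega
  refine ⟨k, hk, ?_, ?_⟩
  · intro m hm
    have hm' : m.val < k.val := hm
    have hd := aux_dm m
    apply aux_move_ne
    · rintro rfl
      simp only [idxDA] at *
      omega
    · rintro rfl
      simp only at *
      omega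
  · simp only [lamDA, hr, hc]
    show f w < moveCfg f u w w
    simp only [moveCfg, hne, if_false, if_true]
    exact aux_add hwv

theorem aux_CD_same {n : ℕ} (f : Fin n × Fin n → Fin 3) (u w : Fin n × Fin n) (m : Fin (n * n))
    (hu : m.val + u.2.val + 1 < n * u.1.val + n) (hw : m.val + w.2.val + 1 < n * w.1.val + n) :
    lamCD (moveCfg f u w) m = lamCD f m := by
  have hd := aux_dm m
  have hr := (rowOf m).2
  apply aux_move_ne
  · rintro rfl
    simp only [Fin.val_rev] at hu
    omega
  · rintro rfl
    simp only [Fin.val_rev] at hw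
    omega

/-- CD decreases when the source precedes the destination in CD-order. -/
theorem aux_CD_lt {n : ℕ} (f : Fin n × Fin n → Fin 3) (u w : Fin n × Fin n)
    (h0 : f u ≠ 0) (h1 : w.1 = u.1) (h2 : w.2.val < u.2.val) :
    toLex (lamCD (moveCfg f u w)) < toLex (lamCD f) := by
  obtain ⟨k, hr, hc, hk⟩ := aux_idx u.2.rev u.1
  rw [aux_lex_iff]
  refine ⟨k, ?_, ?_⟩
  · intro m hm
    have hm' : m.val < k.val := hm
    have := u.2.2
    simp only [Fin.val_rev] at hk
    apply aux_CD_same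
    · omega
    · rw [h1]; omega
  · simp only [lamCD, hr, hc, Fin.rev_rev]
    show moveCfg f u w u < f u
    simp only [moveCfg, if_true]
    exact aux_sub h0

theorem purely_asym_second_move_DA_gt_CD (n : ℕ) (hn : 4 ≤ n) (hne : Even n)
    (f : Fin n × Fin n → Fin 3) (hpa : PurelyAsym f)
    (u₁ u₂ : Fin n × Fin n)
    (h₁ : FirstRobot f u₁) (hsingle : f u₁ = 1) (h₂ : SecondRobot f u₁ u₂)
    (w : Fin n × Fin n) (hw : w = destD u₂) (hwval : f w ≤ 1)
    (f' : Fin n × Fin n → Fin 3) (hf' : f' = moveCfg f u₂ w) :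
    toLex (lamCD f') < toLex (lamDA f') := by
  obtain ⟨hce, -, hmax, -, -⟩ := hpa
  have hCD : toLex (lamCD f) < toLex (lamDA f) := hmax _ (by simp)
  have hu0 := h₂.1
  subst hf'
  unfold destD at hw
  split_ifs at hw with hc
  · -- columnwise move
    have hpos : 0 < u₂.1.val := by
      by_contra hcon
      have h0 : u₂.1.val = 0 := by omega
      rcases hc with h | h | h
      · exact hu0 (hce u₂ (Or.inl h0) (Or.inl h))
      · omega
      · omega
    obtain ⟨a, ha⟩ : ∃ a, u₂.1.val = a + 1 := ⟨u₂.1.val - 1, by omega⟩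
    have hw1 : w.1.val = a := by rw [hw]; simp [ha]
    have hw2 : w.2.val = u₂.2.val := by rw [hw]
    have hul := u₂.1.2
    have hjl := u₂.2.2
    obtain ⟨k, hk, hkeq, hklt⟩ := aux_DA f u₂ w hwval (by
      simp only [idxDA, hw1, hw2, ha]; omega)
    have key : n * u₂.2.val + a + u₂.2.val + 1 < n * a + n := by
      generalize u₂.2.val = j at *
      obtain ⟨t, ht⟩ := hne
      rcases hc with h | ⟨h, h'⟩ | ⟨h, h'⟩
      · subst h; nlinarith
      · subst h
        nlinarith
      · have hja : a = n - 2 := by omega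
        have hjt : j + 1 ≤ t := by omega
        obtain ⟨s, rfl⟩ : ∃ s, t = s + 2 := ⟨t - 2, by omega⟩
        have : a = 2 * s + 2 := by omega
        subst this
        have : n = 2 * s + 4 := by omega
        subst this
        nlinarith
    simp only [idxDA, hw1, hw2] at hk
    have hsame : ∀ m ≤ k, lamCD (moveCfg f u₂ w) m = lamCD f m := by
      intro m hm
      have hm' : m.val ≤ k.val := hm
      apply aux_CD_same
      · rw [ha, Nat.mul_succ]; omega
      · rw [hw1, hw2]; omega
    rw [aux_lex_iff] at hCD ⊢
    obtain ⟨q, hq, hqlt⟩ := hCD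
    rcases lt_or_ge q k with hlt | hge
    · refine ⟨q, fun m hm => ?_, ?_⟩
      · rw [hsame m (hm.trans hlt).le, hkeq m (hm.trans hlt), hq m hm]
      · rw [hsame q hlt.le, hkeq q hlt]; exact hqlt
    · refine ⟨k, fun m hm => ?_, ?_⟩
      · rw [hsame m hm.le, hkeq m hm, hq m (lt_of_lt_of_le hm hge)]
      · rw [hsame k le_rfl]
        refine lt_of_le_of_lt ?_ hklt
        rcases eq_or_lt_of_le hge with h | h
        · rw [h]; exact hqlt.le
        · exact (hq k h).le
  · -- rowwise move
    have hj : 0 < u₂.2.val := by omega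
    have hw1 : w.1 = u₂.1 := by rw [hw]
    have hw2 : w.2.val = u₂.2.val - 1 := by rw [hw]
    obtain ⟨k, hk, hkeq, hklt⟩ := aux_DA f u₂ w hwval (by
      simp only [idxDA, hw1]
      have : w.2.val < u₂.2.val := by omega
      nlinarith)
    refine (aux_CD_lt f u₂ w hu0 hw1 (by omega)).trans (hCD.trans ?_)
    exact (aux_lex_iff _ _).2 ⟨k, fun m hm => (hkeq m hm).symm, hklt⟩
end

section
/- Let n ≥ 4 be even and let f : Fin n × Fin n → Fin 3 be purely asymmetric with largest corner D, whose first occupied node in λ_DA-order is a singleton. Suppose the second robot r_2 of the leading duo, at node (i,j), moves one step according to the movement rule toward D, to a destination node w with f(w) ≤ 1, producing f'. Then λ_DA of f' is strictly greater in lexicographic order than λ_CB of f'. -/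
theorem idxDA_lt_iff {n : ℕ} (p q : Fin n × Fin n) :
    idxDA p < idxDA q ↔ p.2.val < q.2.val ∨ (p.2.val = q.2.val ∧ p.1.val < q.1.val) := by
  obtain ⟨⟨a, ha⟩, ⟨b, hb⟩⟩ := p
  obtain ⟨⟨c, hc⟩, ⟨d, hd⟩⟩ := q
  simp only [idxDA]
  rcases lt_trichotomy b d with h | h | h
  · have : n * (b + 1) ≤ n * d := Nat.mul_le_mul_left n h
    rw [mul_add] at this
    constructor
    · intro _; left; exact h
    · intro _; omega
  · subst h
    omega
  · have : n * (d + 1) ≤ n * b := Nat.mul_le_mul_left n h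
    rw [mul_add] at this
    omega

theorem idx_split {n : ℕ} (k : Fin (n * n)) : idxDA (rowOf k, colOf k) = k.val := by
  simp only [idxDA, rowOf, colOf]
  exact Nat.div_add_mod _ _

theorem idx_surj {n : ℕ} (p : Fin n × Fin n) :
    ∃ k : Fin (n * n), rowOf k = p.1 ∧ colOf k = p.2 := by
  obtain ⟨⟨a, ha⟩, ⟨b, hb⟩⟩ := p
  have hn : 0 < n := by omega
  have hlt : n * b + a < n * n := by
    have : n * (b + 1) ≤ n * n := Nat.mul_le_mul_left n hb
    rw [mul_add] at this
    omega
  refine ⟨⟨n * b + a, hlt⟩, ?_, ?_⟩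
  · simp [rowOf, Nat.mod_eq_of_lt ha]
  · simp [colOf, Nat.mul_add_div hn, Nat.div_eq_of_lt ha]

theorem CB_lt_DA_iff {n : ℕ} (g : Fin n × Fin n → Fin 3) :
    toLex (lamCB g) < toLex (lamDA g) ↔
      ∃ p : Fin n × Fin n, (∀ q, idxDA q < idxDA p → g (q.1, q.2.rev) = g q) ∧
        g (p.1, p.2.rev) < g p := by
  constructor
  · rintro ⟨k, hk, hlt⟩
    refine ⟨(rowOf k, colOf k), ?_, hlt⟩
    intro q hq
    obtain ⟨m, hm1, hm2⟩ := idx_surj q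
    have hq' : q = (rowOf m, colOf m) := by rw [hm1, hm2]
    subst hq'
    rw [idx_split, idx_split] at hq
    exact hk m hq
  · rintro ⟨p, hp, hlt⟩
    obtain ⟨m, hm1, hm2⟩ := idx_surj p
    have hp' : p = (rowOf m, colOf m) := by rw [hm1, hm2]
    subst hp'
    refine ⟨m, ?_, hlt⟩
    intro k hk
    exact hp (rowOf k, colOf k) (by rw [idx_split, idx_split]; exact hk)

theorem fin3_succ {a : Fin 3} (h : a ≤ 1) : a < a + 1 := by
  revert h; revert a; decide

theorem fin3_pred {a : Fin 3} (h : a ≠ 0) : a - 1 ≤ a := by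
  revert h; revert a; decide

theorem node_ext {n : ℕ} {p q : Fin n × Fin n} (h1 : p.1.val = q.1.val)
    (h2 : p.2.val = q.2.val) : p = q :=
  Prod.ext (Fin.ext h1) (Fin.ext h2)

/-- The destination is either one step down in the same column (left half), or one
step left in the same row. -/
theorem dest_cases {n : ℕ} (hn : 4 ≤ n) (u w : Fin n × Fin n) (hw : w = destD u)
    (hc : ¬ (u.1.val = 0 ∧ u.2.val = 0)) :
    (w.2.val = u.2.val ∧ w.1.val + 1 = u.1.val ∧ u.2.val < n / 2) ∨
      (w.1.val = u.1.val ∧ w.2.val + 1 = u.2.val) := by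
  subst hw
  unfold destD
  split_ifs with h
  · left
    dsimp only
    omega
  · right
    dsimp only
    omega

theorem purely_asym_second_move_DA_gt_CB (n : ℕ) (hn : 4 ≤ n) (hne : Even n)
    (f : Fin n × Fin n → Fin 3) (hpa : PurelyAsym f)
    (u₁ u₂ : Fin n × Fin n)
    (h₁ : FirstRobot f u₁) (hsingle : f u₁ = 1) (h₂ : SecondRobot f u₁ u₂)
    (w : Fin n × Fin n) (hw : w = destD u₂) (hwval : f w ≤ 1)
    (f' : Fin n × Fin n → Fin 3) (hf' : f' = moveCfg f u₂ w) :
    toLex (lamCB f') < toLex (lamDA f') := by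
  obtain ⟨m, hm⟩ := hne
  obtain ⟨hcorn, -, hmax, -, -⟩ := hpa
  have hCB : toLex (lamCB f) < toLex (lamDA f) := hmax _ (by simp)
  rw [CB_lt_DA_iff] at hCB ⊢
  obtain ⟨p, hpre, hlt⟩ := hCB
  obtain ⟨hu2, hne21, hu2min⟩ := h₂
  have hc : ¬ (u₂.1.val = 0 ∧ u₂.2.val = 0) := by
    rintro ⟨ha, hb⟩
    exact hu2 (hcorn u₂ (Or.inl ha) (Or.inl hb))
  have hd := dest_cases hn u₂ w hw hc
  have hwu : w ≠ u₂ := by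
    rintro rfl
    omega
  have hoth : ∀ q, q ≠ u₂ → q ≠ w → f' q = f q := by
    intro q h1 h2
    simp [hf', moveCfg, h1, h2]
  have hfw : f' w = f w + 1 := by simp [hf', moveCfg, hwu]
  have hfu : f' u₂ = f u₂ - 1 := by simp [hf', moveCfg]
  by_cases hcol : w.2.val < m
  · -- the destination lies in the left half
    have hpre' : ∀ q, idxDA q < idxDA w →
        f' q = f q ∧ f' (q.1, q.2.rev) = f (q.1, q.2.rev) := by
      intro q hq
      rw [idxDA_lt_iff] at hq
      constructor
      · apply hoth
        · rintro rfl; omega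
        · rintro rfl; omega
      · have hr := Fin.val_rev q.2
        have := q.2.2
        apply hoth
        · intro h
          have e1 : q.1.val = u₂.1.val := by rw [← h]
          have e2 : q.2.rev.val = u₂.2.val := by rw [← h]
          omega
        · intro h
          have e2 : q.2.rev.val = w.2.val := by rw [← h]
          omega
    by_cases hpw : idxDA p < idxDA w
    · refine ⟨p, ?_, ?_⟩
      · intro q hq
        obtain ⟨e1, e2⟩ := hpre' q (hq.trans hpw)
        rw [e1, e2]
        exact hpre q hq
      · obtain ⟨e1, e2⟩ := hpre' p hpw
        rw [e1, e2]
        exact hlt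
    · refine ⟨w, ?_, ?_⟩
      · intro q hq
        obtain ⟨e1, e2⟩ := hpre' q hq
        rw [e1, e2]
        exact hpre q (by omega)
      · have hle : f (w.1, w.2.rev) ≤ f w := by
          rcases lt_or_eq_of_le (not_lt.1 hpw) with h | h
          · exact (hpre w h).le
          · have hwp : w = p := by
              have a1 := idxDA_lt_iff w p
              have a2 := idxDA_lt_iff p w
              apply node_ext <;> omega
            rw [hwp]
            exact hlt.le
        have hle' : f' (w.1, w.2.rev) ≤ f (w.1, w.2.rev) := by
          by_cases h : (w.1, w.2.rev) = u₂
          · rw [h, hfu]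
            exact fin3_pred hu2
          · rw [hoth _ h]
            intro h'
            have hr := Fin.val_rev w.2
            have e2 : w.2.rev.val = w.2.val := congrArg (fun x => x.2.val) h'
            omega
        rw [hfw]
        exact (hle'.trans hle).trans_lt (fin3_succ hwval)
  · -- the destination lies in the right half
    have hp : p.2.val < m := by
      by_contra hcon
      have hr := Fin.val_rev p.2
      have := p.2.2
      have h := hpre (p.1, p.2.rev) (by rw [idxDA_lt_iff]; left; dsimp only; omega)
      simp only [Fin.rev_rev] at h
      rw [← h] at hlt
      exact lt_irrefl _ hlt
    have hp0 : f p ≠ 0 := by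
      intro h
      rw [h] at hlt
      exact absurd hlt (Fin.not_lt_zero _)
    have hpu : p = u₁ := by
      by_contra hcon
      have a := hu2min p hp0 hcon
      have b := idxDA_lt_iff p u₂
      omega
    subst hpu
    have hz : ∀ q, idxDA q < idxDA p → f q = 0 := by
      intro q hq
      by_contra hcon
      have := h₁.2 q hcon
      omega
    have hm0 : f (p.1, p.2.rev) = 0 := by
      rw [hsingle] at hlt
      revert hlt
      generalize f (p.1, p.2.rev) = x
      revert x
      decide
    have hmz : ∀ q, idxDA q ≤ idxDA p → f (q.1, q.2.rev) = 0 := by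
      intro q hq
      rcases lt_or_eq_of_le hq with h | h
      · rw [hpre q h, hz q h]
      · have hqp : q = p := by
          have a1 := idxDA_lt_iff q p
          have a2 := idxDA_lt_iff p q
          apply node_ext <;> omega
        rw [hqp, hm0]
    have key : ∀ q, idxDA q ≤ idxDA p →
        f' q = f q ∧ f' (q.1, q.2.rev) = f (q.1, q.2.rev) := by
      intro q hq
      have a := idxDA_lt_iff p q
      constructor
      · apply hoth
        · rintro rfl; omega
        · rintro rfl; omega
      · apply hoth
        · intro h
          exact hu2 (h ▸ hmz q hq)
        · intro h
          have e1 : q.1.val = w.1.val := by rw [← h]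
          have e2 : q.2.rev.val = w.2.val := by rw [← h]
          have hr := Fin.val_rev q.2
          have hr2 := Fin.val_rev u₂.2
          have l1 := q.2.2
          have l2 := u₂.2.2
          have b : idxDA (u₂.1, u₂.2.rev) < idxDA q := by
            rw [idxDA_lt_iff]; left; dsimp only; omega
          have := hmz (u₂.1, u₂.2.rev) (by omega)
          simp only [Fin.rev_rev] at this
          exact hu2 this
    refine ⟨p, ?_, ?_⟩
    · intro q hq
      obtain ⟨e1, e2⟩ := key q hq.le
      rw [e1, e2]
      exact hpre q hq
    · obtain ⟨e1, e2⟩ := key p le_rfl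
      rw [e1, e2]
      exact hlt
end

section
/- Let n ≥ 4 be even, let f : Fin n × Fin n → Fin 3 be a critical configuration with largest corner D, and let f' be the configuration obtained by moving the second robot r_2 one step according to the movement rule toward D (so f' is almost symmetric of the second type). Then the second largest corner of f' is A, not C: the lexicographic maximum of {λ_AD(f'), λ_AB(f'), λ_CB(f'), λ_CD(f')} is attained by λ_AD(f') or λ_AB(f') and not by λ_CB(f') or λ_CD(f'). -/
/-! ## Auxiliary lemmas -/

/-- the node read at position `k` of the DA reading -/
def auxNode {n : ℕ} (k : Fin (n * n)) : Fin n × Fin n := (rowOf k, colOf k)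

/-- the DA reading order on nodes -/
def NLt {n : ℕ} (p q : Fin n × Fin n) : Prop :=
  p.2.val < q.2.val ∨ (p.2.val = q.2.val ∧ p.1.val < q.1.val)

theorem idx_lt_iff {n : ℕ} (p q : Fin n × Fin n) : idxDA p < idxDA q ↔ NLt p q := by
  obtain ⟨⟨a, ha⟩, ⟨b, hb⟩⟩ := p
  obtain ⟨⟨c, hc⟩, ⟨d, hd⟩⟩ := q
  simp only [idxDA, NLt]
  rcases lt_trichotomy b d with h | h | h
  · have : n * (b + 1) ≤ n * d := Nat.mul_le_mul_left n h
    rw [Nat.mul_add] at this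
    constructor
    · intro; omega
    · intro; omega
  · subst h; omega
  · have : n * (d + 1) ≤ n * b := Nat.mul_le_mul_left n h
    rw [Nat.mul_add] at this
    constructor
    · intro; omega
    · intro; omega

theorem auxNode_surj {n : ℕ} (p : Fin n × Fin n) : ∃ k : Fin (n * n), auxNode k = p ∧ k.val = idxDA p := by
  obtain ⟨⟨a, ha⟩, ⟨b, hb⟩⟩ := p
  have hlt : n * b + a < n * n := by
    have : n * (b + 1) ≤ n * n := Nat.mul_le_mul_left n hb
    rw [Nat.mul_add] at this
    omega
  refine ⟨⟨n * b + a, hlt⟩, ?_, rfl⟩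
  have h0 : 0 < n := by omega
  simp only [auxNode, rowOf, colOf, Prod.mk.injEq, Fin.mk.injEq]
  constructor
  · rw [Nat.mul_add_mod, Nat.mod_eq_of_lt ha]
  · rw [Nat.mul_add_div h0, Nat.div_eq_of_lt ha, Nat.add_zero]

theorem idx_auxNode {n : ℕ} (k : Fin (n * n)) : idxDA (auxNode k) = k.val := by
  simp only [idxDA, auxNode, rowOf, colOf]
  exact Nat.div_add_mod k.val n

theorem idx_inj {n : ℕ} {p q : Fin n × Fin n} (h : idxDA p = idxDA q) : p = q := by
  obtain ⟨k, hk, hk'⟩ := auxNode_surj p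
  obtain ⟨l, hl, hl'⟩ := auxNode_surj q
  have : k = l := Fin.ext (by omega)
  rw [← hk, ← hl, this]

/-- a lexicographic inequality between readings excludes a witness of the opposite strict one -/
theorem lex_no {n : ℕ} (F G : Fin n × Fin n → Fin 3)
    (h : toLex (fun k : Fin (n * n) => F (auxNode k)) ≤ toLex (fun k : Fin (n * n) => G (auxNode k)))
    (t : Fin n × Fin n) (ht : G t < F t) (hx : ∀ x, NLt x t → G x ≤ F x) : False := by
  obtain ⟨kt, hkt, hkt'⟩ := auxNode_surj t
  rcases h.lt_or_eq with h | h
  · obtain ⟨i, hi, hlt⟩ := h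
    simp only [Pi.toLex_apply] at hi hlt
    rcases lt_trichotomy i kt with hik | hik | hik
    · have := hx (auxNode i) (by
        rw [← idx_lt_iff, idx_auxNode, ← hkt']; exact hik)
      exact absurd hlt (not_lt.mpr this)
    · subst hik
      rw [hkt] at hlt
      exact absurd hlt (not_lt.mpr ht.le)
    · have := hi kt hik
      rw [hkt] at this
      exact absurd this ht.ne'
  · have := congrFun (toLex_inj.mp h) kt
    simp only [hkt] at this
    exact absurd this ht.ne'

theorem lex_first {n : ℕ} (F G : Fin n × Fin n → Fin 3)
    (h : toLex (fun k : Fin (n * n) => F (auxNode k)) ≤ toLex (fun k : Fin (n * n) => G (auxNode k)))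
    (t : Fin n × Fin n) (ht : F t ≠ 0) : ∃ x, G x ≠ 0 ∧ ¬ NLt t x := by
  by_contra hcon
  push Not at hcon
  have h0 : ∀ x, ¬ NLt t x → G x = 0 := by
    intro x hx
    by_contra h
    exact hx (hcon x h)
  refine lex_no F G h t ?_ ?_
  · rw [h0 t (by simp [NLt])]
    exact Fin.pos_iff_ne_zero.mpr ht
  · intro x hx
    rw [h0 x (by unfold NLt at *; omega)]
    exact Fin.zero_le _

theorem exists_first {n : ℕ} (S : Fin n × Fin n → Fin 3) (z : Fin n × Fin n) (hz : S z ≠ 0) :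
    ∃ x, S x ≠ 0 ∧ ∀ y, S y ≠ 0 → idxDA x ≤ idxDA y := by
  obtain ⟨x, hx, hmin⟩ := Finset.exists_min_image
    (Finset.univ.filter (fun x => S x ≠ 0)) idxDA ⟨z, by simpa using hz⟩
  refine ⟨x, by simpa using hx, fun y hy => hmin y (by simpa using hy)⟩

theorem zeroFirst_node {n : ℕ} (S : Fin n × Fin n → Fin 3) (x₁ : Fin n × Fin n)
    (h1 : S x₁ ≠ 0) (hmin : ∀ y, S y ≠ 0 → idxDA x₁ ≤ idxDA y) (k : Fin (n * n)) :
    zeroFirst (fun k : Fin (n * n) => S (auxNode k)) k = if auxNode k = x₁ then 0 else S (auxNode k) := by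
  unfold zeroFirst
  split_ifs with ha hb hb
  · rfl
  · exfalso
    apply hb
    apply idx_inj
    apply le_antisymm _ (hmin _ ha.1)
    by_contra hlt
    push Not at hlt
    obtain ⟨l, hl, hl'⟩ := auxNode_surj x₁
    rw [idx_auxNode] at hlt
    have := ha.2 l (Fin.lt_def.mpr (by omega))
    simp only [hl] at this
    exact h1 this
  · exfalso
    apply ha
    refine ⟨by simpa only [hb] using h1, ?_⟩
    intro j hj
    by_contra hne
    have := hmin _ hne
    rw [← hb, idx_auxNode, idx_auxNode] at this
    exact absurd hj (not_lt.mpr (Fin.le_def.mpr this))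
  · rfl

theorem symA_symA {n : ℕ} (p : Fin n × Fin n) : symA (symA p) = p := by
  simp [symA]

/-- structure of a configuration whose two `C`-readings agree after zeroing the first robots -/
theorem exists_P {n : ℕ} (g : Fin n × Fin n → Fin 3) (hm : NoMult g)
    (hz : zeroFirst (lamCB g) = zeroFirst (lamCD g)) (has : g ≠ g ∘ symA)
    (z : Fin n × Fin n) (hgz : g z ≠ 0) :
    ∃ P, g P ≠ 0 ∧ g (symA P) = 0 ∧ (∀ y, g y ≠ 0 → idxDA (symV P) ≤ idxDA (symV y)) ∧
      (∀ y, g y ≠ 0 → idxDA (symR1inv P) ≤ idxDA (symR1inv y)) ∧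
      (∀ y, y ≠ P → g y ≠ 0 → g (symA y) ≠ 0) := by
  have h01 : ∀ p, g p ≠ 0 → g p = 1 := by
    intro p hp
    have := hm p
    revert hp this
    generalize g p = v
    revert v
    decide
  obtain ⟨x₁, hx1, hm1⟩ := exists_first (fun x => g (symV x)) (symV z) (by simpa [symV] using hgz)
  obtain ⟨x₂, hx2, hm2⟩ := exists_first (fun x => g (symR1 x)) (symR1inv z)
    (by simpa [symR1, symR1inv] using hgz)
  have key : ∀ x, (if x = x₁ then 0 else g (symV x)) = (if x = x₂ then 0 else g (symR1 x)) := by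
    intro x
    obtain ⟨k, hk, -⟩ := auxNode_surj x
    have := congrFun hz k
    have e1 := zeroFirst_node (fun x => g (symV x)) x₁ hx1 hm1 k
    have e2 := zeroFirst_node (fun x => g (symR1 x)) x₂ hx2 hm2 k
    rw [hk] at e1 e2
    rw [← e1, ← e2]
    exact this
  have hd : ∀ x : Fin n × Fin n, symR1 x = symV (symD x) := fun x => rfl
  have hne : x₁ ≠ x₂ := by
    intro he
    apply has
    funext p
    have := key (symV p)
    have hA : symR1 (symV p) = symA p := rfl
    have hV : symV (symV p) = p := by simp [symV]
    rw [hA, hV, ← he] at this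
    simp only [Function.comp]
    split_ifs at this with hc
    · have a1 := h01 _ hx1
      rw [← he] at hx2
      have a2 := h01 _ hx2
      rw [← hc] at a1 a2
      rw [hA] at a2
      rw [hV] at a1
      rw [a1, a2]
    · exact this
  have hT1 : g (symR1 x₁) = 0 := by
    have := key x₁
    rw [if_pos rfl, if_neg hne] at this
    exact this.symm
  have hS2 : g (symV x₂) = 0 := by
    have := key x₂
    rw [if_pos rfl, if_neg hne.symm] at this
    exact this
  have hx12 : symD x₂ = x₁ := by
    by_contra hc
    have := key (symD x₂)
    rw [if_neg hc] at this
    have h3 : symR1 (symD x₂) = symV x₂ := rfl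
    have h4 : symD x₂ ≠ x₂ := by
      intro h
      apply hx2
      rw [hd, h]
      exact hS2
    rw [if_neg h4, h3, hS2] at this
    exact hx2 this
  refine ⟨symV x₁, hx1, by simpa [symA, symV, symR1] using hT1, ?_, ?_, ?_⟩
  · intro y hy
    have e : symV (symV x₁) = x₁ := by simp [symV]
    rw [e]
    exact hm1 (symV y) (by simpa [symV] using hy)
  · intro y hy
    have e : symR1inv (symV x₁) = x₂ := by rw [← hx12]; simp [symV, symR1inv, symD]
    rw [e]
    exact hm2 (symR1inv y) (by simpa [symR1, symR1inv] using hy)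
  · intro y hyP hy
    have := key (symV y)
    have hA : symR1 (symV y) = symA y := rfl
    have hV : symV (symV y) = y := by simp [symV]
    rw [hA, hV] at this
    have n1 : symV y ≠ x₁ := by
      intro h
      exact hyP (by rw [← h, hV])
    rw [if_neg n1] at this
    split_ifs at this with h2
    · exact absurd this hy
    · rw [← this]; exact hy

/-- key structural lemma on the configuration after the move -/
theorem core {n : ℕ} (hne : Even n) (g : Fin n × Fin n → Fin 3)
    (hm : NoMult g) (hmax : DAStrictMax g) (hC : SecondIsC g)
    (P : Fin n × Fin n) (hP : g P ≠ 0) (hAP : g (symA P) = 0)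
    (hCB : ∀ y, g y ≠ 0 → idxDA (symV P) ≤ idxDA (symV y))
    (hCD : ∀ y, g y ≠ 0 → idxDA (symR1inv P) ≤ idxDA (symR1inv y))
    (hsy : ∀ y, y ≠ P → g y ≠ 0 → g (symA y) ≠ 0)
    (q₁ q₂ : Fin n × Fin n) (hq1 : g q₁ ≠ 0) (hq2 : g q₂ ≠ 0) (hlt : NLt q₁ q₂)
    (hq : ∀ y, g y ≠ 0 → y ≠ q₁ → ¬ NLt y q₂) :
    q₁ ≠ P ∧ q₂ ≠ P ∧ symA q₁ ≠ q₂ := by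
  have h01 : ∀ p, g p ≠ 0 → g p = 1 := by
    intro p hp
    have := hm p
    revert hp this
    generalize g p = v
    revert v
    decide
  have mCD : toLex (lamCD g) ≤ toLex (lamDA g) := (hmax _ (by simp)).le
  have mBC : toLex (lamBC g) ≤ toLex (lamDA g) := (hmax _ (by simp)).le
  -- first elements
  have hfirst : ∀ y, g y ≠ 0 → ¬ NLt y q₁ := by
    intro y hy hl
    by_cases hyq : y = q₁
    · subst hyq; simp [NLt] at hl
    · have := hq y hy hyq
      unfold NLt at *
      omega
  obtain ⟨⟨a, ha⟩, ⟨b, hb⟩⟩ := P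
  obtain ⟨⟨r, hr⟩, ⟨c, hc⟩⟩ := q₁
  -- DA versus BC
  have h1 : a + b + 1 < n := by
    have hnot : ¬ NLt (symA (⟨a, ha⟩, ⟨b, hb⟩)) ((⟨a, ha⟩, ⟨b, hb⟩) : Fin n × Fin n) := by
      intro hl
      refine lex_no (fun x => g (symA x)) g mBC (symA (⟨a, ha⟩, ⟨b, hb⟩)) ?_ ?_
      · simp only [symA_symA, hAP]
        exact Fin.pos_iff_ne_zero.mpr hP
      · intro x hx
        by_cases hgx : g x = 0
        · rw [hgx]; exact Fin.zero_le _
        · have : x ≠ (⟨a, ha⟩, ⟨b, hb⟩) := by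
            rintro rfl
            unfold NLt at *
            omega
          have h2 := hsy x this hgx
          rw [h01 _ hgx, h01 _ h2]
    have hself : symA ((⟨a, ha⟩, ⟨b, hb⟩) : Fin n × Fin n) ≠ (⟨a, ha⟩, ⟨b, hb⟩) := by
      intro h
      rw [h] at hAP
      exact hP hAP
    simp only [NLt, symA, Fin.val_rev] at hnot
    simp only [symA, ne_eq, Prod.mk.injEq, Fin.ext_iff, Fin.val_rev] at hself
    omega
  have hCB' : ∀ i j : Fin n, g (i, j) ≠ 0 → j.val < b ∨ (j.val = b ∧ a ≤ i.val) := by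
    intro i j hij
    have := hCB _ hij
    rw [← not_lt, idx_lt_iff] at this
    simp only [NLt, symV, Fin.val_rev] at this
    omega
  have hCD' : ∀ i j : Fin n, g (i, j) ≠ 0 → a < i.val ∨ (i.val = a ∧ j.val ≤ b) := by
    intro i j hij
    have := hCD _ hij
    rw [← not_lt, idx_lt_iff] at this
    simp only [NLt, symR1inv, Fin.val_rev] at this
    omega
  -- C versus A
  have hF : ∀ i j : Fin n, g (i, j) ≠ 0 →
      a < j.val ∨ (a = j.val ∧ i.val ≤ b) := by
    intro i j hij
    rcases hC with hC | hC
    · have h := hC (lamAD g) (by simp)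
      obtain ⟨x, hx, hx'⟩ := lex_first (fun x => g (symH x)) (fun x => g (symV x)) h
        (i.rev, j) (by simpa [symH] using hij)
      have := hCB' _ _ hx
      simp only [NLt, Fin.val_rev] at *
      omega
    · have h := hC (lamAD g) (by simp)
      obtain ⟨x, hx, hx'⟩ := lex_first (fun x => g (symH x)) (fun x => g (symR1 x)) h
        (i.rev, j) (by simpa [symH] using hij)
      have := hCD' _ _ hx
      simp only [NLt, Fin.val_rev] at *
      omega
  -- DA versus CD, first element
  have h2 : c < a ∨ (c = a ∧ r + b + 1 ≤ n) := by
    obtain ⟨x, hx, hx'⟩ := lex_first (fun x => g (symR1 x)) g mCD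
      (symR1inv (⟨a, ha⟩, ⟨b, hb⟩)) (by simpa [symR1, symR1inv] using hP)
    have := hfirst x hx
    simp only [NLt, symR1inv, Fin.val_rev] at *
    omega
  have h3 := hF _ _ hq1
  simp only at h3
  have hca : c = a := by omega
  subst hca
  have hrb : r ≤ b := by omega
  have hq1P : ((⟨r, hr⟩, ⟨c, hc⟩) : Fin n × Fin n) ≠ (⟨c, ha⟩, ⟨b, hb⟩) := by
    intro h
    simp only [Prod.mk.injEq, Fin.mk.injEq] at h
    have e1 := hF q₂.1 q₂.2 hq2
    have e2 := hCB' q₂.1 q₂.2 hq2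
    simp only [NLt] at hlt
    omega
  have hs1 := hsy _ hq1P hq1
  have e1 := hCB' _ _ hs1
  simp only [Fin.val_rev] at e1
  obtain ⟨m, hmm⟩ := hne
  have hr' : r + b + 1 = n := by omega
  refine ⟨hq1P, ?_, ?_⟩
  · intro h
    subst h
    refine lex_no (fun x => g (symR1 x)) g mCD (symR1inv (⟨r, hr⟩, ⟨c, hc⟩)) ?_ ?_
    · have e : symR1 (symR1inv ((⟨r, hr⟩, ⟨c, hc⟩) : Fin n × Fin n)) = (⟨r, hr⟩, ⟨c, hc⟩) := by
        simp [symR1, symR1inv]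
      simp only [e]
      have : g (symR1inv (⟨r, hr⟩, ⟨c, hc⟩)) = 0 := by
        by_contra hne0
        have := hq _ hne0 (by
          simp only [symR1inv, ne_eq, Prod.mk.injEq, Fin.ext_iff, Fin.val_rev]
          omega)
        simp only [NLt, symR1inv] at this
        omega
      rw [this]
      exact Fin.pos_iff_ne_zero.mpr hq1
    · intro x hx
      by_cases hgx : g x = 0
      · rw [hgx]; exact Fin.zero_le _
      · have hxq : x = (⟨r, hr⟩, ⟨c, hc⟩) := by
          by_contra hxne
          have := hq _ hgx hxne
          simp only [NLt, symR1inv] at *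
          omega
        subst hxq
        have e : symR1 ((⟨r, hr⟩, ⟨c, hc⟩) : Fin n × Fin n) = (⟨c, ha⟩, ⟨b, hb⟩) := by
          refine Prod.ext rfl (Fin.ext ?_)
          simp only [symR1, Fin.val_rev]
          omega
        simp only [e]
        rw [h01 _ hgx, h01 _ hP]
  · intro h
    subst h
    have := hq _ hP hq1P.symm
    simp only [NLt, symA, Fin.val_rev] at this
    omega

theorem destD_cases {n : ℕ} (u : Fin n × Fin n) (hu : ¬ (u.1.val = 0 ∧ u.2.val = 0)) (hn : 4 ≤ n) :
    ((destD u).1.val + 1 = u.1.val ∧ (destD u).2.val = u.2.val) ∨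
    ((destD u).1.val = u.1.val ∧ (destD u).2.val + 1 = u.2.val) := by
  unfold destD
  split_ifs with h
  · left
    simp only [and_true]
    omega
  · right
    simp only [true_and]
    omega

/-- the second largest corner after the move cannot be `C` -/
theorem not_C {n : ℕ} (hn : 4 ≤ n) (hne : Even n)
    (f : Fin n × Fin n → Fin 3) (hpa : PurelyAsym f)
    (u₁ u₂ : Fin n × Fin n)
    (h₁ : FirstRobot f u₁) (hsingle : f u₁ = 1) (h₂ : SecondRobot f u₁ u₂)
    (g : Fin n × Fin n → Fin 3) (hg : g = moveCfg f u₂ (destD u₂))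
    (hm : NoMult g) (has : Asymmetric g) (hmax : DAStrictMax g) (hC : SecondIsC g)
    (hz : zeroFirst (lamCB g) = zeroFirst (lamCD g)) : False := by
  obtain ⟨hce, -, hfmax, -, -⟩ := hpa
  have mBC : toLex (lamBC f) ≤ toLex (lamDA f) := (hfmax _ (by simp)).le
  have h01 : ∀ p, g p ≠ 0 → g p = 1 := by
    intro p hp
    have := hm p
    revert hp this
    generalize g p = v
    revert v
    decide
  have hu0 : ¬ (u₂.1.val = 0 ∧ u₂.2.val = 0) := by
    rintro ⟨h, h'⟩
    exact h₂.1 (hce u₂ (Or.inl h) (Or.inl h'))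
  have hd := destD_cases u₂ hu0 hn
  set w := destD u₂ with hw
  have hwu : NLt w u₂ := by unfold NLt; omega
  have hwne : w ≠ u₂ := by
    intro h; rw [h] at hwu; simp [NLt] at hwu
  have hocc : ∀ x, f x ≠ 0 → x ≠ u₁ → ¬ NLt x u₂ := by
    intro x hx hx1
    rw [← idx_lt_iff]
    exact not_lt.mpr (h₂.2.2 x hx hx1)
  have h12 : NLt u₁ u₂ := by
    rw [← idx_lt_iff]
    refine lt_of_le_of_ne (h₁.2 _ h₂.1) ?_
    intro h
    exact h₂.2.1 (idx_inj h).symm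
  have gw : g w = f w + 1 := by rw [hg]; simp [moveCfg, hwne]
  have gu : g u₂ = f u₂ - 1 := by rw [hg]; simp [moveCfg]
  have go : ∀ x, x ≠ u₂ → x ≠ w → g x = f x := by
    intro x h h'
    rw [hg]; simp [moveCfg, h, h']
  have hwu1 : w ≠ u₁ := by
    intro h
    apply hm w
    rw [gw, h, hsingle]
    rfl
  have fw : f w = 0 := by
    by_contra h
    exact hocc w h hwu1 hwu
  have gw1 : g w = 1 := by rw [gw, fw]; rfl
  have gu1 : g u₁ = 1 := by rw [go u₁ h₂.2.1.symm hwu1.symm, hsingle]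
  have hgocc : ∀ x, g x ≠ 0 → x ≠ u₁ → x ≠ w → ¬ NLt x u₂ := by
    intro x hx hx1 hxw
    by_cases hxu : x = u₂
    · subst hxu; simp [NLt]
    · rw [go x hxu hxw] at hx
      exact hocc x hx hx1
  have hfge : ∀ x, x ≠ w → g x ≤ f x := by
    intro x hxw
    by_cases hxu : x = u₂
    · subst hxu
      rw [gu]
      have := h₂.1
      revert this
      generalize f x = v
      revert v
      decide
    · rw [go x hxu hxw]
  obtain ⟨P, hP, hAP, hCB, hCD, hsy⟩ := exists_P g hm hz (has _ (by simp)) w (by rw [gw1]; decide)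
  have hcore : u₁ ≠ P ∧ w ≠ P ∧ symA u₁ ≠ w := by
    have hcases : NLt u₁ w ∨ NLt w u₁ := by
      rcases lt_trichotomy (idxDA u₁) (idxDA w) with h | h | h
      · exact Or.inl ((idx_lt_iff _ _).mp h)
      · exact absurd (idx_inj h).symm hwu1
      · exact Or.inr ((idx_lt_iff _ _).mp h)
    rcases hcases with hl | hl
    · refine core hne g hm hmax hC P hP hAP hCB hCD hsy u₁ w (by rw [gu1]; decide)
        (by rw [gw1]; decide) hl ?_
      intro y hy hy1
      by_cases hyw : y = w
      · subst hyw; simp [NLt]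
      · have := hgocc y hy hy1 hyw
        unfold NLt at *
        omega
    · have := core hne g hm hmax hC P hP hAP hCB hCD hsy w u₁ (by rw [gw1]; decide)
        (by rw [gu1]; decide) hl ?_
      · refine ⟨this.2.1, this.1, ?_⟩
        intro h
        apply this.2.2
        rw [← h, symA_symA]
      intro y hy hyw
      by_cases hy1 : y = u₁
      · subst hy1; simp [NLt]
      · have := hgocc y hy hy1 hyw
        unfold NLt at *
        omega
  obtain ⟨hu1P, hwP, hA1⟩ := hcore
  have gA1 : g (symA u₁) = 1 := h01 _ (hsy u₁ hu1P (by rw [gu1]; decide))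
  have fA1 : f u₁ ≤ f (symA u₁) := by
    have := hfge _ hA1
    rw [gA1] at this
    rw [hsingle]; exact this
  have hle : ∀ x, NLt x u₂ → f x ≤ f (symA x) := by
    intro x hx
    by_cases hfx : f x = 0
    · rw [hfx]; exact Fin.zero_le _
    · by_cases hx1 : x = u₁
      · rw [hx1]; exact fA1
      · exact absurd hx (hocc x hfx hx1)
  by_cases hww : symA w = w
  · have hlt : NLt (symA u₂) u₂ := by
      simp only [symA, Prod.ext_iff, Fin.ext_iff, Fin.val_rev] at hww
      simp only [NLt, symA, Fin.val_rev]
      omega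
    refine lex_no (fun x => f (symA x)) f mBC (symA u₂) ?_ ?_
    · simp only [symA_symA]
      by_cases hs : symA u₂ = u₁
      · have e : symA u₁ = u₂ := by rw [← hs, symA_symA]
        rw [e, gu] at gA1
        rw [hs, hsingle]
        revert gA1
        generalize f u₂ = v
        revert v
        decide
      · have : f (symA u₂) = 0 := by
          by_contra h
          exact hocc _ h hs hlt
        rw [this]
        exact Fin.pos_iff_ne_zero.mpr h₂.1
    · intro x hx
      exact hle x (by unfold NLt at *; omega)
  · refine lex_no (fun x => f (symA x)) f mBC w ?_ ?_
    · have h1 := h01 _ (hsy w hwP (by rw [gw1]; decide))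
      have := hfge _ hww
      rw [h1] at this
      simp only [fw]
      exact lt_of_lt_of_le (by decide) this
    · intro x hx
      exact hle x (by unfold NLt at *; omega)

theorem fun_of_lex {n : ℕ} (F G : Fin n × Fin n → Fin 3)
    (h : toLex (fun k : Fin (n * n) => F (auxNode k)) ≤ toLex (fun k : Fin (n * n) => G (auxNode k)))
    (h' : toLex (fun k : Fin (n * n) => G (auxNode k)) ≤ toLex (fun k : Fin (n * n) => F (auxNode k)))
    (x : Fin n × Fin n) : F x = G x := by
  obtain ⟨k, hk, -⟩ := auxNode_surj x
  have := congrFun (toLex_inj.mp (le_antisymm h h')) k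
  simp only [hk] at this
  exact this

/-- for an asymmetric configuration the second largest corner is unique -/
theorem not_both {n : ℕ} (g : Fin n × Fin n → Fin 3) (has : Asymmetric g)
    (hA : SecondIsA g) (hC : SecondIsC g) : False := by
  have hD : g ≠ g ∘ symD := has _ (by simp)
  have hR : g ≠ g ∘ symR2 := has _ (by simp)
  rcases hA with hA | hA <;> rcases hC with hC | hC
  · apply hR
    funext p
    have := fun_of_lex (fun x => g (symH x)) (fun x => g (symV x))
      (hC (lamAD g) (by simp)) (hA (lamCB g) (by simp)) (symV p)
    simpa [symH, symV, symR2] using this.symm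
  · apply hD
    funext p
    have := fun_of_lex (fun x => g (symH x)) (fun x => g (symR1 x))
      (hC (lamAD g) (by simp)) (hA (lamCD g) (by simp)) (symH p)
    simpa [symH, symR1, symD] using this
  · apply hD
    funext p
    have := fun_of_lex (fun x => g (symR1inv x)) (fun x => g (symV x))
      (hC (lamAB g) (by simp)) (hA (lamCB g) (by simp)) (symV p)
    simpa [symR1inv, symV, symD] using this.symm
  · apply hR
    funext p
    have := fun_of_lex (fun x => g (symR1inv x)) (fun x => g (symR1 x))
      (hC (lamAB g) (by simp)) (hA (lamCD g) (by simp)) (symR1inv p)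
    simpa [symR1inv, symR1, symR2] using this.symm

/-- Lemma 5.4 (critical): in a critical configuration with largest corner D, the
configuration f' obtained by the move of the second robot is almost symmetric of the
second type with second largest corner A, not C: the maximum of the four corner
sequences of f' is attained by λ_AD or λ_AB and by neither λ_CB nor λ_CD. -/
theorem critical_second_largest_is_A (n : ℕ) (hn : 4 ≤ n) (hne : Even n)
    (f : Fin n × Fin n → Fin 3) (hpa : PurelyAsym f)
    (u₁ u₂ : Fin n × Fin n)
    (h₁ : FirstRobot f u₁) (hsingle : f u₁ = 1) (h₂ : SecondRobot f u₁ u₂)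
    (hcrit : AlmostSym2 (moveCfg f u₂ (destD u₂)))
    (f' : Fin n × Fin n → Fin 3) (hf' : f' = moveCfg f u₂ (destD u₂)) :
    SecondIsA f' ∧ ¬ AttainsMax4 f' (lamCB f') ∧ ¬ AttainsMax4 f' (lamCD f') := by
  subst hf'
  obtain ⟨-, hm, has, hmax, hcase⟩ := hcrit
  rcases hcase with ⟨hA, -⟩ | ⟨hC, hz⟩
  · exact ⟨hA, fun h => not_both _ has hA (Or.inl h), fun h => not_both _ has hA (Or.inr h)⟩
  · exact (not_C hn hne f hpa u₁ u₂ h₁ hsingle h₂ _ rfl hm has hmax hC hz).elim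
end
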